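/- For all integers 1 ≤ s < t ≤ T and every bounded measurable function h : X → ℝ with φ_{s|T}(h) = 0, φ_{t-1|t-1}(υ_{s,t,T}) · φ_{t-1|t-1}(ϑ_t) / (φ_{t|t-1}(g_t·L_{t,T}(·,1)))² ≤ (σ₊²/(σ₋·c₋))²·ρ^{2(t−s)}·osc(h)²·‖ω_t‖_∞·‖ϑ_t‖_∞·‖g_t‖_∞ / σ₋. -/

import Mathlib

open MeasureTheory

noncomputable section

variable {X : Type*} [MeasurableSpace X]

/-- `ell ν q g s n x y` is the kernel density `ℓ_{s, s+n+1}(x, y)`: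
`ℓ_{s,s+1}(x,y) = q(x,y) g_{s+1}(y)` and
`ℓ_{s,t+1}(x,y) = ∫ ℓ_{s,t}(x,z) q(z,y) g_{t+1}(y) ν(dz)`. -/
def ell (ν : Measure X) (q : X → X → ℝ) (g : ℕ → X → ℝ) (s : ℕ) : ℕ → X → X → ℝ
  | 0 => fun x y => q x y * g (s + 1) y
  | n + 1 => fun x y => ∫ z, ell ν q g s n x z * (q z y * g (s + n + 2) y) ∂ν

/-- `ℓ_{s,t}` for `s < t`. -/
def ellST (ν : Measure X) (q : X → X → ℝ) (g : ℕ → X → ℝ) (s t : ℕ) : X → X → ℝ :=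
  ell ν q g s (t - s - 1)

/-- `L_{s,t}(x,h) = ∫ ℓ_{s,t}(x,y) h(y) ν(dy)`, with the convention `L_{t,t}(x,h) = h x`. -/
def Lop (ν : Measure X) (q : X → X → ℝ) (g : ℕ → X → ℝ) (s t : ℕ) (x : X) (h : X → ℝ) : ℝ :=
  if s < t then ∫ y, ellST ν q g s t x y * h y ∂ν else h x

/-- filtering distribution `φ_{t|t}(h)` (for `t = 0` this is `χ(g₀h)/χ(g₀)`). -/
def philt (ν χ : Measure X) (q : X → X → ℝ) (g : ℕ → X → ℝ) (t : ℕ) (h : X → ℝ) : ℝ :=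
  (∫ x, g 0 x * Lop ν q g 0 t x h ∂χ) / ∫ x, g 0 x * Lop ν q g 0 t x (fun _ => 1) ∂χ

/-- one-step predictor `φ_{t|t-1}(h) = φ_{t-1|t-1}(x ↦ ∫ q(x,y)h(y)ν(dy))`. -/
def phipred (ν χ : Measure X) (q : X → X → ℝ) (g : ℕ → X → ℝ) (t : ℕ) (h : X → ℝ) : ℝ :=
  philt ν χ q g (t - 1) (fun x => ∫ y, q x y * h y ∂ν)

/-- importance weight `ω_t(x,x') = q(x,x') g_t(x') / (ϑ_t(x) p_t(x,x'))`. -/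
def omegaFn (q : X → X → ℝ) (g : ℕ → X → ℝ) (ϑ : ℕ → X → ℝ) (p : ℕ → X → X → ℝ)
    (t : ℕ) (x y : X) : ℝ :=
  q x y * g t y / (ϑ t x * p t x y)

/-- oscillation of a function -/
def osc {Y : Type*} (h : Y → ℝ) : ℝ := ⨆ pr : Y × Y, |h pr.1 - h pr.2|

/-- marginal smoothing distribution `φ_{s|T}(h)`. -/
def phismooth (ν χ : Measure X) (q : X → X → ℝ) (g : ℕ → X → ℝ) (s T : ℕ) (h : X → ℝ) : ℝ :=
  philt ν χ q g s (fun x => h x * Lop ν q g s T x fun _ => 1) /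
    philt ν χ q g s (fun x => Lop ν q g s T x fun _ => 1)

/-- unnormalized joint smoothing functional of the states at times `s` and `t1` (`s ≤ t1`). -/
def jointNum (ν χ : Measure X) (q : X → X → ℝ) (g : ℕ → X → ℝ) (s t1 : ℕ)
    (ψ : X → X → ℝ) : ℝ :=
  ∫ x0, g 0 x0 * ∫ xs, ellST ν q g 0 s x0 xs *
    (if s < t1 then ∫ y, ellST ν q g s t1 xs y * ψ xs y ∂ν else ψ xs xs) ∂ν ∂χ

/-- joint smoothing distribution `φ_{s,t1|t1}(ψ)` (`s ≤ t1`). -/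
def jointSm (ν χ : Measure X) (q : X → X → ℝ) (g : ℕ → X → ℝ) (s t1 : ℕ)
    (ψ : X → X → ℝ) : ℝ :=
  jointNum ν χ q g s t1 ψ / jointNum ν χ q g s t1 fun _ _ => 1

/-- `g_{s,t,T}(x')`. -/
def gstT (ν χ : Measure X) (q : X → X → ℝ) (g : ℕ → X → ℝ) (h : X → ℝ)
    (s t T : ℕ) (x' : X) : ℝ :=
  jointSm ν χ q g s (t - 1) (fun xs y => h xs * q y x') * Lop ν q g t T x' (fun _ => 1) /
    philt ν χ q g (t - 1) (fun x => q x x')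

/-- `υ_{s,t,T}(x) = ϑ_t(x) ∫ p_t(x,x') ω_t(x,x')² g_{s,t,T}(x')² ν(dx')`. -/
def upsilon (ν χ : Measure X) (q : X → X → ℝ) (g : ℕ → X → ℝ)
    (ϑ : ℕ → X → ℝ) (p : ℕ → X → X → ℝ) (h : X → ℝ) (s t T : ℕ) (x : X) : ℝ :=
  ϑ t x * ∫ x', p t x x' * omegaFn q g ϑ p t x x' ^ 2 * gstT ν χ q g h s t T x' ^ 2 ∂ν

end

/-- Bounded measurable real functions. -/
def BddMeas {α : Type*} [MeasurableSpace α] (f : α → ℝ) : Prop :=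
  Measurable f ∧ ∃ K, ∀ x, |f x| ≤ K

namespace BddMeas

variable {α β : Type*} [MeasurableSpace α] [MeasurableSpace β]

theorem const (c : ℝ) : BddMeas fun _ : α => c :=
  ⟨measurable_const, |c|, fun _ => le_rfl⟩

theorem mul {f f' : α → ℝ} (hf : BddMeas f) (hf' : BddMeas f') :
    BddMeas fun x => f x * f' x := by
  obtain ⟨hm, K, hK⟩ := hf
  obtain ⟨hm', K', hK'⟩ := hf'
  refine ⟨hm.mul hm', K * K', fun x => ?_⟩
  rw [abs_mul]
  exact mul_le_mul (hK x) (hK' x) (abs_nonneg _) ((abs_nonneg _).trans (hK x))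

theorem sub {f f' : α → ℝ} (hf : BddMeas f) (hf' : BddMeas f') :
    BddMeas fun x => f x - f' x := by
  obtain ⟨hm, K, hK⟩ := hf
  obtain ⟨hm', K', hK'⟩ := hf'
  exact ⟨hm.sub hm', K + K', fun x => (abs_sub _ _).trans (add_le_add (hK x) (hK' x))⟩

theorem comp {f : β → ℝ} (hf : BddMeas f) {u : α → β} (hu : Measurable u) :
    BddMeas fun x => f (u x) :=
  ⟨hf.1.comp hu, hf.2.imp fun _ hK x => hK (u x)⟩

theorem integrable {f : α → ℝ} (hf : BddMeas f) (μ : Measure α) [IsFiniteMeasure μ] :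
    Integrable f μ := by
  obtain ⟨hm, K, hK⟩ := hf
  exact Integrable.of_bound hm.aestronglyMeasurable K (Filter.Eventually.of_forall hK)

theorem integral {F : α → β → ℝ} (hF : BddMeas fun pr : α × β => F pr.1 pr.2)
    (μ : Measure β) [IsFiniteMeasure μ] : BddMeas fun a => ∫ b, F a b ∂μ := by
  obtain ⟨hm, K, hK⟩ := hF
  refine ⟨hm.stronglyMeasurable.integral_prod_right'.measurable, K * μ.real Set.univ,
    fun a => ?_⟩
  exact norm_integral_le_of_norm_le_const (f := F a)
    (Filter.Eventually.of_forall fun b => hK (a, b))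

theorem integral_swap {F : α → β → ℝ} (hF : BddMeas fun pr : α × β => F pr.1 pr.2)
    (μ : Measure α) (μ' : Measure β) [IsFiniteMeasure μ] [IsFiniteMeasure μ'] :
    ∫ a, ∫ b, F a b ∂μ' ∂μ = ∫ b, ∫ a, F a b ∂μ ∂μ' :=
  integral_integral_swap (hF.integrable (μ.prod μ'))

end BddMeas

/-- A weighted average of `f ≥ 0` with weights in `[a, b]` dominates `a / b` times its
unweighted average. -/
theorem mul_integral_div_le_integral_mul_div {α : Type*} [MeasurableSpace α] {μ : Measure α}
    [IsFiniteMeasure μ] (hμ : 0 < μ.real Set.univ) {a b : ℝ} (ha : 0 < a) {w f : α → ℝ}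
    (hw : BddMeas w) (hwab : ∀ x, a ≤ w x ∧ w x ≤ b) (hf : BddMeas f) (hf0 : ∀ x, 0 ≤ f x) :
    a / b * ((∫ x, f x ∂μ) / μ.real Set.univ) ≤ (∫ x, f x * w x ∂μ) / ∫ x, w x ∂μ := by
  have hlow : a * μ.real Set.univ ≤ ∫ x, w x ∂μ := by
    have := integral_mono ((BddMeas.const a).integrable μ) (hw.integrable μ) fun x => (hwab x).1
    simpa [mul_comm] using this
  have hup : ∫ x, w x ∂μ ≤ b * μ.real Set.univ := by
    have := integral_mono (hw.integrable μ) ((BddMeas.const b).integrable μ) fun x => (hwab x).2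
    simpa [mul_comm] using this
  have hnum : a * ∫ x, f x ∂μ ≤ ∫ x, f x * w x ∂μ := by
    rw [← integral_const_mul]
    refine integral_mono (((BddMeas.const a).mul hf).integrable μ) ((hf.mul hw).integrable μ)
      fun x => ?_
    simpa [mul_comm] using mul_le_mul_of_nonneg_left (hwab x).1 (hf0 x)
  have hwpos : 0 < ∫ x, w x ∂μ := (mul_pos ha hμ).trans_le hlow
  have hfpos : 0 ≤ ∫ x, f x ∂μ := integral_nonneg hf0
  calc a / b * ((∫ x, f x ∂μ) / μ.real Set.univ)
      = (a * ∫ x, f x ∂μ) / (b * μ.real Set.univ) := by rw [div_mul_div_comm]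
    _ ≤ (∫ x, f x * w x ∂μ) / ∫ x, w x ∂μ :=
        div_le_div₀ ((mul_nonneg ha.le hfpos).trans hnum) hnum hwpos hup

/-- Weighted averages with weights in `[a, b]` of a function with values in `[c, c + d]` all lie
in a common interval of length `(1 - a / b) * d`. -/
theorem integral_mul_div_mem_interval {α : Type*} [MeasurableSpace α] {μ : Measure α}
    [IsFiniteMeasure μ] (hμ : 0 < μ.real Set.univ) {a b c d : ℝ} (ha : 0 < a) {w f : α → ℝ}
    (hw : BddMeas w) (hwab : ∀ x, a ≤ w x ∧ w x ≤ b) (hf : BddMeas f)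
    (hfc : ∀ x, c ≤ f x ∧ f x ≤ c + d) :
    a / b * ((∫ x, f x ∂μ) / μ.real Set.univ) + (1 - a / b) * c ≤
        (∫ x, f x * w x ∂μ) / ∫ x, w x ∂μ ∧
      (∫ x, f x * w x ∂μ) / ∫ x, w x ∂μ ≤
        a / b * ((∫ x, f x ∂μ) / μ.real Set.univ) + (1 - a / b) * c + (1 - a / b) * d := by
  have hwpos : 0 < ∫ x, w x ∂μ := by
    have := integral_mono ((BddMeas.const a).integrable μ) (hw.integrable μ) fun x => (hwab x).1
    have hpos := mul_pos hμ ha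
    simp only [integral_const, smul_eq_mul] at this
    linarith
  have lower := mul_integral_div_le_integral_mul_div hμ ha hw hwab (hf.sub (BddMeas.const c))
    fun x => sub_nonneg.2 (hfc x).1
  have upper := mul_integral_div_le_integral_mul_div hμ ha hw hwab
    ((BddMeas.const (c + d)).sub hf) fun x => sub_nonneg.2 (hfc x).2
  simp only [sub_mul] at lower upper
  rw [integral_sub (hf.integrable μ) ((BddMeas.const c).integrable μ),
    integral_sub ((hf.mul hw).integrable μ) (((BddMeas.const c).mul hw).integrable μ),
    integral_const_mul, integral_const, smul_eq_mul, sub_div, sub_div,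
    mul_div_cancel_left₀ _ hμ.ne', mul_div_cancel_right₀ _ hwpos.ne'] at lower
  rw [integral_sub ((BddMeas.const (c + d)).integrable μ) (hf.integrable μ),
    integral_sub (((BddMeas.const (c + d)).mul hw).integrable μ) ((hf.mul hw).integrable μ),
    integral_const_mul, integral_const, smul_eq_mul, sub_div, sub_div,
    mul_div_cancel_left₀ _ hμ.ne', mul_div_cancel_right₀ _ hwpos.ne'] at upper
  constructor <;> linarith

/-- Standing assumptions on the transition density `q` and the potentials `g`. -/
structure MixingModel {X : Type*} [MeasurableSpace X] (ν : Measure X) (q : X → X → ℝ)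
    (g : ℕ → X → ℝ) (σm σp cm : ℝ) : Prop where
  measurable_q : Measurable fun pr : X × X => q pr.1 pr.2
  q_mem : ∀ x y, σm ≤ q x y ∧ q x y ≤ σp
  low_pos : 0 < σm
  cm_pos : 0 < cm
  bddMeas_g : ∀ t, BddMeas (g t)
  g_nonneg : ∀ t x, 0 ≤ g t x
  le_integral : ∀ t, 1 ≤ t → ∀ x, cm ≤ ∫ y, q x y * g t y ∂ν

/-- The one-step operator `f ↦ (x ↦ ∫ q(x,y) g(y) f(y) ν(dy))`. -/
noncomputable def stepOp {X : Type*} [MeasurableSpace X] (ν : Measure X) (q : X → X → ℝ)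
    (g f : X → ℝ) (x : X) : ℝ :=
  ∫ y, q x y * g y * f y ∂ν

/-- The unnormalized filtering measure at time `t`. -/
noncomputable def unnormFilter {X : Type*} [MeasurableSpace X] (ν χ : Measure X)
    (q : X → X → ℝ) (g : ℕ → X → ℝ) : ℕ → Measure X
  | 0 => χ.withDensity fun x => ENNReal.ofReal (g 0 x)
  | n + 1 => ν.withDensity fun y =>
      ENNReal.ofReal (g (n + 1) y * ∫ x, q x y ∂(unnormFilter ν χ q g n))

/-- The conditional mean of `h(X_s)` given `X_{s+n}` and the observations up to time `s+n-1`. -/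
noncomputable def backwardMean {X : Type*} [MeasurableSpace X] (ν χ : Measure X)
    (q : X → X → ℝ) (g : ℕ → X → ℝ) (h : X → ℝ) (s : ℕ) : ℕ → X → ℝ
  | 0 => h
  | n + 1 => fun y =>
      (∫ x, backwardMean ν χ q g h s n x * q x y ∂(unnormFilter ν χ q g (s + n))) /
        ∫ x, q x y ∂(unnormFilter ν χ q g (s + n))

theorem integral_withDensity_ofReal {α : Type*} [MeasurableSpace α] (μ : Measure α)
    {w : α → ℝ} (hw : Measurable w) (hw0 : ∀ x, 0 ≤ w x) (f : α → ℝ) :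
    ∫ x, f x ∂(μ.withDensity fun x => ENNReal.ofReal (w x)) = ∫ x, w x * f x ∂μ := by
  rw [integral_withDensity_eq_integral_toReal_smul hw.ennreal_ofReal
    (Filter.Eventually.of_forall fun _ => ENNReal.ofReal_lt_top)]
  simp [ENNReal.toReal_ofReal (hw0 _)]

namespace MixingModel

variable {X : Type*} [MeasurableSpace X] {ν χ : Measure X} {q : X → X → ℝ} {g : ℕ → X → ℝ} {σm σp cm : ℝ}

theorem bddMeas_q (M : MixingModel ν q g σm σp cm) :
    BddMeas fun pr : X × X => q pr.1 pr.2 :=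
  ⟨M.measurable_q, σp, fun pr => abs_le.2
    ⟨by linarith [M.q_mem pr.1 pr.2, M.low_pos], (M.q_mem pr.1 pr.2).2⟩⟩

theorem bddMeas_q_left (M : MixingModel ν q g σm σp cm) (y : X) : BddMeas fun x => q x y :=
  M.bddMeas_q.comp (measurable_id.prodMk measurable_const)

theorem q_pos (M : MixingModel ν q g σm σp cm) (x y : X) : 0 < q x y :=
  M.low_pos.trans_le (M.q_mem x y).1

theorem bddMeas_qg (M : MixingModel ν q g σm σp cm) (t : ℕ) :
    BddMeas fun pr : X × X => q pr.1 pr.2 * g t pr.2 :=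
  M.bddMeas_q.mul ((M.bddMeas_g t).comp measurable_snd)

theorem Lop_self (s : ℕ) (x : X) (f : X → ℝ) : Lop ν q g s s x f = f x := by
  simp [Lop]

theorem Lop_one_step (s : ℕ) (x : X) (f : X → ℝ) :
    Lop ν q g s (s + 1) x f = stepOp ν q (g (s + 1)) f x := by
  simp [Lop, ellST, ell, stepOp]

theorem stepOp_nonneg (M : MixingModel ν q g σm σp cm) (t : ℕ) {f : X → ℝ}
    (hf : ∀ x, 0 ≤ f x) (x : X) : 0 ≤ stepOp ν q (g t) f x :=
  integral_nonneg fun y => mul_nonneg (mul_nonneg (M.q_pos x y).le (M.g_nonneg t y)) (hf y)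

variable [IsProbabilityMeasure ν] [IsProbabilityMeasure χ]

theorem bddMeas_stepOp (M : MixingModel ν q g σm σp cm) (t : ℕ) {f : X → ℝ}
    (hf : BddMeas f) : BddMeas (stepOp ν q (g t) f) :=
  ((M.bddMeas_qg t).mul (hf.comp measurable_snd)).integral ν

theorem stepOp_le_mul_stepOp (M : MixingModel ν q g σm σp cm) (t : ℕ) {f : X → ℝ}
    (hf : BddMeas f) (hf0 : ∀ x, 0 ≤ f x) (x y : X) :
    stepOp ν q (g t) f x ≤ σp / σm * stepOp ν q (g t) f y := by
  have hint (z : X) : BddMeas fun w => q z w * g t w * f w :=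
    ((M.bddMeas_qg t).comp (measurable_const.prodMk measurable_id)).mul hf
  unfold stepOp
  rw [← integral_const_mul]
  refine integral_mono ((hint x).integrable ν)
    (((BddMeas.const (σp / σm)).mul (hint y)).integrable ν) fun w => ?_
  have hq : q x w ≤ σp / σm * q y w := by
    rw [div_mul_eq_mul_div, le_div_iff₀ M.low_pos]
    exact mul_le_mul (M.q_mem x w).2 (M.q_mem y w).1 M.low_pos.le
      ((M.q_pos x w).le.trans (M.q_mem x w).2)
  have := mul_le_mul_of_nonneg_right hq (mul_nonneg (M.g_nonneg t w) (hf0 w))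
  simp only
  linarith

theorem bddMeas_ell (M : MixingModel ν q g σm σp cm) (s n : ℕ) :
    BddMeas fun pr : X × X => ell ν q g s n pr.1 pr.2 := by
  induction n with
  | zero => exact M.bddMeas_qg (s + 1)
  | succ n ih =>
    have hF : BddMeas fun r : (X × X) × X =>
        ell ν q g s n r.1.1 r.2 * (q r.2 r.1.2 * g (s + n + 2) r.1.2) :=
      (ih.comp (measurable_fst.fst.prodMk measurable_snd)).mul
        ((M.bddMeas_qg (s + n + 2)).comp (measurable_snd.prodMk measurable_fst.snd))
    exact hF.integral (F := fun (a : X × X) b => ell ν q g s n a.1 b * (q b a.2 * g (s + n + 2) a.2)) ν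

theorem Lop_succ (M : MixingModel ν q g σm σp cm) (s n : ℕ) (x : X) {f : X → ℝ}
    (hf : BddMeas f) :
    Lop ν q g s (s + n + 1) x f = Lop ν q g s (s + n) x (stepOp ν q (g (s + n + 1)) f) := by
  cases n with
  | zero => rw [add_zero, Lop_self, Lop_one_step]
  | succ n =>
    have e₁ : s + (n + 1) + 1 - s - 1 = n + 1 := by omega
    have e₂ : s + (n + 1) - s - 1 = n := by omega
    simp only [Lop, ellST, e₁, e₂, ell, if_pos (show s < s + (n + 1) + 1 by omega),
      if_pos (show s < s + (n + 1) by omega), stepOp]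
    have hF : BddMeas fun r : X × X =>
        ell ν q g s n x r.2 * (q r.2 r.1 * g (s + n + 2) r.1) * f r.1 :=
      (((M.bddMeas_ell s n).comp (measurable_const.prodMk measurable_snd)).mul
        ((M.bddMeas_qg (s + n + 2)).comp measurable_swap)).mul (hf.comp measurable_fst)
    have swap := hF.integral_swap
      (F := fun y z => ell ν q g s n x z * (q z y * g (s + n + 2) y) * f y) ν ν
    simp only [integral_mul_const] at swap
    refine swap.trans (integral_congr_ae (Filter.Eventually.of_forall fun z => ?_))
    simp only [mul_assoc, integral_const_mul]
    rfl

theorem bddMeas_Lop (M : MixingModel ν q g σm σp cm) (s n : ℕ) {f : X → ℝ}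
    (hf : BddMeas f) : BddMeas fun x => Lop ν q g s (s + n) x f := by
  induction n generalizing f with
  | zero => simpa only [add_zero, Lop_self] using hf
  | succ n ih =>
    simp only [← add_assoc, M.Lop_succ s n _ hf]
    exact ih (M.bddMeas_stepOp _ hf)

theorem Lop_nonneg (M : MixingModel ν q g σm σp cm) (s n : ℕ) {f : X → ℝ}
    (hf : BddMeas f) (hf0 : ∀ x, 0 ≤ f x) (x : X) : 0 ≤ Lop ν q g s (s + n) x f := by
  induction n generalizing f with
  | zero => simpa only [add_zero, Lop_self] using hf0 x
  | succ n ih =>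
    rw [← add_assoc, M.Lop_succ s n _ hf]
    exact ih (M.bddMeas_stepOp _ hf) (M.stepOp_nonneg _ hf0)

theorem Lop_comp (M : MixingModel ν q g σm σp cm) (s m n : ℕ) (x : X) {f : X → ℝ}
    (hf : BddMeas f) :
    Lop ν q g s (s + m + n) x f =
      Lop ν q g s (s + m) x fun y => Lop ν q g (s + m) (s + m + n) y f := by
  induction n generalizing f with
  | zero => simp only [add_zero, Lop_self]
  | succ n ih =>
    have hl := M.Lop_succ s (m + n) x hf
    simp only [← add_assoc] at hl ⊢
    rw [hl, ih (M.bddMeas_stepOp _ hf)]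
    simp only [M.Lop_succ (s + m) n _ hf]

theorem Lop_one_le_mul (M : MixingModel ν q g σm σp cm) (s n : ℕ) (x y : X) :
    Lop ν q g s (s + n) x (fun _ => 1) ≤ σp / σm * Lop ν q g s (s + n) y fun _ => 1 := by
  cases n with
  | zero =>
    simp only [add_zero, Lop_self, mul_one]
    exact (one_le_div M.low_pos).2 ((M.q_mem x y).1.trans (M.q_mem x y).2)
  | succ n =>
    have h1 := BddMeas.const (α := X) 1
    rw [show s + (n + 1) = s + 1 + n by omega, M.Lop_comp s 1 n x h1, M.Lop_comp s 1 n y h1,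
      Lop_one_step, Lop_one_step]
    exact M.stepOp_le_mul_stepOp _ (M.bddMeas_Lop _ _ h1)
      (M.Lop_nonneg _ _ h1 fun _ => zero_le_one) x y

theorem isFiniteMeasure_unnormFilter (M : MixingModel ν q g σm σp cm) (n : ℕ) :
    IsFiniteMeasure (unnormFilter ν χ q g n) := by
  induction n with
  | zero => exact isFiniteMeasure_withDensity_ofReal ((M.bddMeas_g 0).integrable χ).2
  | succ n ih =>
    exact isFiniteMeasure_withDensity_ofReal (((M.bddMeas_g (n + 1)).mul
      ((M.bddMeas_q.comp measurable_swap).integral (F := fun y x => q x y) _)).integrable ν).2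

theorem integral_unnormFilter_succ (M : MixingModel ν q g σm σp cm) (n : ℕ) (f : X → ℝ) :
    ∫ x, f x ∂(unnormFilter ν χ q g (n + 1)) =
      ∫ y, g (n + 1) y * (∫ x, q x y ∂(unnormFilter ν χ q g n)) * f y ∂ν := by
  have := M.isFiniteMeasure_unnormFilter (χ := χ) n
  exact integral_withDensity_ofReal ν ((M.bddMeas_g (n + 1)).mul
      ((M.bddMeas_q.comp measurable_swap).integral (F := fun y x => q x y) _)).1
    (fun y => mul_nonneg (M.g_nonneg _ y) (integral_nonneg fun x => (M.q_pos x y).le)) f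

theorem integral_mul_stepOp (M : MixingModel ν q g σm σp cm) (n : ℕ) {f f' : X → ℝ}
    (hf : BddMeas f) (hf' : BddMeas f') :
    ∫ x, f' x * stepOp ν q (g (n + 1)) f x ∂(unnormFilter ν χ q g n) =
      ∫ y, g (n + 1) y * (∫ x, f' x * q x y ∂(unnormFilter ν χ q g n)) * f y ∂ν := by
  have := M.isFiniteMeasure_unnormFilter (χ := χ) n
  have hF : BddMeas fun r : X × X => f' r.1 * (q r.1 r.2 * g (n + 1) r.2 * f r.2) :=
    (hf'.comp measurable_fst).mul ((M.bddMeas_qg (n + 1)).mul (hf.comp measurable_snd))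
  have swap := hF.integral_swap (F := fun x y => f' x * (q x y * g (n + 1) y * f y))
    (unnormFilter ν χ q g n) ν
  simp only [integral_const_mul] at swap
  unfold stepOp
  rw [swap]
  refine integral_congr_ae (Filter.Eventually.of_forall fun y => ?_)
  simp only [← integral_const_mul, ← integral_mul_const]
  refine integral_congr_ae (Filter.Eventually.of_forall fun x => ?_)
  ring

theorem integral_stepOp (M : MixingModel ν q g σm σp cm) (n : ℕ) {f : X → ℝ}
    (hf : BddMeas f) :
    ∫ x, stepOp ν q (g (n + 1)) f x ∂(unnormFilter ν χ q g n) =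
      ∫ x, f x ∂(unnormFilter ν χ q g (n + 1)) := by
  rw [M.integral_unnormFilter_succ]
  simpa using M.integral_mul_stepOp (χ := χ) n hf (BddMeas.const 1)

theorem integral_Lop_zero (M : MixingModel ν q g σm σp cm) (n : ℕ) {f : X → ℝ}
    (hf : BddMeas f) :
    ∫ x, g 0 x * Lop ν q g 0 n x f ∂χ = ∫ x, f x ∂(unnormFilter ν χ q g n) := by
  induction n generalizing f with
  | zero =>
    simp only [Lop_self]
    exact (integral_withDensity_ofReal χ (M.bddMeas_g 0).1 (M.g_nonneg 0) f).symm
  | succ n ih =>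
    have hl (x : X) := M.Lop_succ 0 n x hf
    simp only [zero_add] at hl
    simp only [hl]
    rw [ih (M.bddMeas_stepOp _ hf), M.integral_stepOp n hf]

theorem philt_eq (M : MixingModel ν q g σm σp cm) (n : ℕ) {f : X → ℝ} (hf : BddMeas f) :
    philt ν χ q g n f =
      (∫ x, f x ∂(unnormFilter ν χ q g n)) / (unnormFilter ν χ q g n).real Set.univ := by
  rw [philt, M.integral_Lop_zero n hf, M.integral_Lop_zero n (BddMeas.const 1)]
  simp

theorem mul_mass_le_mass_succ (M : MixingModel ν q g σm σp cm) (n : ℕ) :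
    cm * (unnormFilter ν χ q g n).real Set.univ ≤
      (unnormFilter ν χ q g (n + 1)).real Set.univ := by
  have := M.isFiniteMeasure_unnormFilter (χ := χ) n
  have h1 := BddMeas.const (α := X) 1
  have h := integral_mono ((BddMeas.const cm).integrable (unnormFilter ν χ q g n))
    ((M.bddMeas_stepOp (n + 1) h1).integrable (unnormFilter ν χ q g n))
    fun x => by simpa [stepOp] using M.le_integral (n + 1) (by omega) x
  rw [M.integral_stepOp n h1] at h
  simpa [mul_comm] using h

theorem mass_pos (M : MixingModel ν q g σm σp cm) (hχ : cm ≤ ∫ x, g 0 x ∂χ) (n : ℕ) :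
    0 < (unnormFilter ν χ q g n).real Set.univ := by
  induction n with
  | zero =>
    have h := M.integral_Lop_zero (χ := χ) 0 (BddMeas.const 1)
    simp only [Lop_self, mul_one, integral_const, smul_eq_mul] at h
    rw [← h]
    exact M.cm_pos.trans_le hχ
  | succ n ih => exact (mul_pos M.cm_pos ih).trans_le (M.mul_mass_le_mass_succ n)

theorem integral_q_pos (M : MixingModel ν q g σm σp cm) (hχ : cm ≤ ∫ x, g 0 x ∂χ) (n : ℕ)
    (y : X) : 0 < ∫ x, q x y ∂(unnormFilter ν χ q g n) := by
  have := M.isFiniteMeasure_unnormFilter (χ := χ) n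
  have h := integral_mono ((BddMeas.const σm).integrable (unnormFilter ν χ q g n))
    ((M.bddMeas_q_left y).integrable (unnormFilter ν χ q g n)) fun x => (M.q_mem x y).1
  simp only [integral_const, smul_eq_mul] at h
  exact (mul_pos (M.mass_pos hχ n) M.low_pos).trans_le h

theorem backwardMean_mem_interval (M : MixingModel ν q g σm σp cm)
    (hχ : cm ≤ ∫ x, g 0 x ∂χ) {h : X → ℝ} (hh : BddMeas h) {c d : ℝ}
    (hcd : ∀ x, c ≤ h x ∧ h x ≤ c + d) (s n : ℕ) :
    BddMeas (backwardMean ν χ q g h s n) ∧ ∃ c', ∀ x, c' ≤ backwardMean ν χ q g h s n x ∧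
      backwardMean ν χ q g h s n x ≤ c' + (1 - σm / σp) ^ n * d := by
  induction n with
  | zero => exact ⟨hh, c, by simpa [backwardMean] using hcd⟩
  | succ n ih =>
    obtain ⟨hB, c', hc'⟩ := ih
    have := M.isFiniteMeasure_unnormFilter (χ := χ) (s + n)
    have hI (y : X) := integral_mul_div_mem_interval (M.mass_pos hχ (s + n)) M.low_pos
      (M.bddMeas_q_left y) (fun x => M.q_mem x y) hB hc'
    refine ⟨⟨?_, ?_⟩, ?_⟩
    · have hnum : BddMeas fun r : X × X => backwardMean ν χ q g h s n r.2 * q r.2 r.1 :=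
        (hB.comp measurable_snd).mul (M.bddMeas_q.comp measurable_swap)
      exact (hnum.integral (F := fun y x => backwardMean ν χ q g h s n x * q x y) _).1.div
        ((M.bddMeas_q.comp measurable_swap).integral (F := fun y x => q x y) _).1
    · exact ⟨_, fun y => abs_le_max_abs_abs (hI y).1 (hI y).2⟩
    · refine ⟨_, fun y => ⟨(hI y).1, (hI y).2.trans_eq ?_⟩⟩
      rw [pow_succ']
      ring

theorem integral_mul_Lop (M : MixingModel ν q g σm σp cm) (hχ : cm ≤ ∫ x, g 0 x ∂χ)
    {h : X → ℝ} (hh : ∀ n s, BddMeas (backwardMean ν χ q g h s n)) (s n : ℕ) {f : X → ℝ}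
    (hf : BddMeas f) :
    ∫ x, h x * Lop ν q g s (s + n) x f ∂(unnormFilter ν χ q g s) =
      ∫ x, backwardMean ν χ q g h s n x * f x ∂(unnormFilter ν χ q g (s + n)) := by
  induction n generalizing f with
  | zero => simp [Lop_self, backwardMean]
  | succ n ih =>
    simp only [← add_assoc, M.Lop_succ s n _ hf]
    rw [ih (M.bddMeas_stepOp _ hf), M.integral_mul_stepOp _ hf (hh n s),
      M.integral_unnormFilter_succ]
    refine integral_congr_ae (Filter.Eventually.of_forall fun y => ?_)
    have := (M.integral_q_pos hχ (s + n) y).ne'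
    simp only [backwardMean]
    field_simp

theorem integral_Lop (M : MixingModel ν q g σm σp cm) (s n : ℕ) {f : X → ℝ}
    (hf : BddMeas f) :
    ∫ x, Lop ν q g s (s + n) x f ∂(unnormFilter ν χ q g s) =
      ∫ x, f x ∂(unnormFilter ν χ q g (s + n)) := by
  induction n generalizing f with
  | zero => simp [Lop_self]
  | succ n ih =>
    simp only [← add_assoc, M.Lop_succ s n _ hf]
    rw [ih (M.bddMeas_stepOp _ hf), M.integral_stepOp _ hf]

theorem jointNum_eq (M : MixingModel ν q g σm σp cm) {s : ℕ} (hs : 1 ≤ s) (n : ℕ)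
    {f f' : X → ℝ} (hf : BddMeas f) (hf' : BddMeas f') :
    jointNum ν χ q g s (s + n) (fun x y => f' x * f y) =
      ∫ x, f' x * Lop ν q g s (s + n) x f ∂(unnormFilter ν χ q g s) := by
  rw [← M.integral_Lop_zero s (hf'.mul (M.bddMeas_Lop s n hf)), jointNum]
  have hin (x : X) : (if s < s + n then ∫ y, ellST ν q g s (s + n) x y * (f' x * f y) ∂ν
      else f' x * f x) = f' x * Lop ν q g s (s + n) x f := by
    simp only [Lop]
    split_ifs
    · rw [← integral_const_mul]
      exact integral_congr_ae (Filter.Eventually.of_forall fun y => mul_left_comm _ _ _)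
    · rfl
  simp only [hin]
  simp only [Lop, if_pos (show 0 < s by omega)]

theorem gstT_eq (M : MixingModel ν q g σm σp cm) (hχ : cm ≤ ∫ x, g 0 x ∂χ)
    {h : X → ℝ} (hh : ∀ n s, BddMeas (backwardMean ν χ q g h s n)) {s : ℕ} (hs : 1 ≤ s)
    (n T : ℕ) (x : X) :
    gstT ν χ q g h s (s + n + 1) T x =
      backwardMean ν χ q g h s (n + 1) x * Lop ν q g (s + n + 1) T x fun _ => 1 := by
  have h1 := BddMeas.const (α := X) 1
  have hone := M.jointNum_eq (χ := χ) hs n h1 h1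
  simp only [one_mul] at hone
  rw [gstT, Nat.add_sub_cancel, jointSm, M.jointNum_eq (f' := h) hs n (M.bddMeas_q_left x) (hh 0 s),
    hone,
    M.integral_mul_Lop hχ hh s n (M.bddMeas_q_left x), M.integral_Lop s n h1,
    M.philt_eq _ (M.bddMeas_q_left x)]
  have hm := (M.mass_pos hχ (s + n)).ne'
  have hq := (M.integral_q_pos hχ (s + n) x).ne'
  simp only [integral_const, smul_eq_mul, mul_one, backwardMean]
  field_simp

end MixingModel

theorem exists_interval_of_osc {Y : Type*} [Nonempty Y] {h : Y → ℝ} (hh : ∃ K, ∀ x, |h x| ≤ K) :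
    ∃ c, ∀ x, c ≤ h x ∧ h x ≤ c + osc h := by
  obtain ⟨K, hK⟩ := hh
  have hbdd : BddAbove (Set.range fun pr : Y × Y => |h pr.1 - h pr.2|) := by
    refine ⟨K + K, ?_⟩
    rintro _ ⟨pr, rfl⟩
    exact (abs_sub _ _).trans (add_le_add (hK _) (hK _))
  refine ⟨⨅ x, h x, fun x => ⟨ciInf_le ⟨-K, ?_⟩ x, ?_⟩⟩
  · rintro _ ⟨y, rfl⟩
    exact (abs_le.1 (hK y)).1
  · have : h x - osc h ≤ ⨅ y, h y := le_ciInf fun y => by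
      have := (le_abs_self _).trans (le_ciSup hbdd (x, y))
      simp only [osc]
      linarith
    linarith

theorem stmt_14 {X : Type*} [MeasurableSpace X] (ν : Measure X) (hν : ν Set.univ = 1)
    (σm σp cm : ℝ) (hσm : 0 < σm) (hσmp : σm ≤ σp) (hcm : 0 < cm)
    (q : X → X → ℝ) (hqmeas : Measurable fun pr : X × X => q pr.1 pr.2)
    (hq : ∀ x y, σm ≤ q x y ∧ q x y ≤ σp)
    (χ : Measure X) [IsProbabilityMeasure χ]
    (g : ℕ → X → ℝ) (hgmeas : ∀ t, Measurable (g t))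
    (hg0 : ∀ t x, 0 ≤ g t x) (hgb : ∃ K, ∀ t x, g t x ≤ K)
    (hχg0 : cm ≤ ∫ x, g 0 x ∂χ)
    (hqg : ∀ t, 1 ≤ t → ∀ x, cm ≤ ∫ y, q x y * g t y ∂ν)
    (ϑ : ℕ → X → ℝ) (hϑmeas : ∀ t, Measurable (ϑ t))
    (hϑpos : ∀ t, 1 ≤ t → ∀ x, 0 < ϑ t x)
    (hϑb : ∃ K, ∀ t, 1 ≤ t → ∀ x, ϑ t x ≤ K)
    (p : ℕ → X → X → ℝ) (hpmeas : ∀ t, Measurable fun pr : X × X => p t pr.1 pr.2)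
    (hppos : ∀ t, 1 ≤ t → ∀ x y, 0 < p t x y)
    (hpint : ∀ t, 1 ≤ t → ∀ x, ∫ y, p t x y ∂ν = 1)
    (hωb : ∃ K, ∀ t, 1 ≤ t → ∀ x y, omegaFn q g ϑ p t x y ≤ K)
    (s t T : ℕ) (hs : 1 ≤ s) (hst : s < t) (htT : t ≤ T)
    (h : X → ℝ) (hhm : Measurable h) (hhb : ∃ K, ∀ x, |h x| ≤ K)
    (hzero : phismooth ν χ q g s T h = 0) :
    philt ν χ q g (t - 1) (upsilon ν χ q g ϑ p h s t T) * philt ν χ q g (t - 1) (ϑ t) /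
        phipred ν χ q g t (fun x => g t x * Lop ν q g t T x fun _ => 1) ^ 2 ≤
      (σp ^ 2 / (σm * cm)) ^ 2 * (1 - σm / σp) ^ (2 * (t - s)) * osc h ^ 2 *
        (⨆ pr : X × X, |omegaFn q g ϑ p t pr.1 pr.2|) * (⨆ x, |ϑ t x|) *
        (⨆ x, |g t x|) / σm := by
  have : IsProbabilityMeasure ν := ⟨hν⟩
  obtain ⟨Kg, hKg⟩ := hgb
  obtain ⟨Kϑ, hKϑ⟩ := hϑb
  obtain ⟨Kω, hKω⟩ := hωb
  have hgabs : ∀ t x, |g t x| ≤ Kg := fun t x => by rw [abs_of_nonneg (hg0 t x)]; exact hKg t x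
  have M : MixingModel ν q g σm σp cm :=
    ⟨hqmeas, hq, hσm, hcm, fun t => ⟨hgmeas t, Kg, hgabs t⟩, hg0, hqg⟩
  have hX : Nonempty X := by
    by_contra hne
    have := not_nonempty_iff.1 hne
    simp [Set.univ_eq_empty_iff.2 this] at hν
  obtain ⟨c, hc⟩ := exists_interval_of_osc hhb
  have hhB : BddMeas h := ⟨hhm, hhb⟩
  have hB (n s : ℕ) : BddMeas (backwardMean ν χ q g h s n) :=
    (M.backwardMean_mem_interval hχg0 hhB hc s n).1
  obtain ⟨n, rfl⟩ : ∃ n, t = s + n + 1 := ⟨t - s - 1, by omega⟩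
  obtain ⟨k, rfl⟩ := Nat.exists_eq_add_of_le htT
  obtain ⟨c', hc'⟩ := (M.backwardMean_mem_interval hχg0 hhB hc s (n + 1)).2
  have h1 := BddMeas.const (α := X) 1
  set t := s + n + 1 with ht
  set A := backwardMean ν χ q g h s (n + 1) with hA
  set L : X → ℝ := fun x => Lop ν q g t (t + k) x fun _ => 1 with hL
  set R := (1 - σm / σp) ^ (n + 1) * osc h with hR
  set γ := unnormFilter ν χ q g (s + n) with hγ
  set γt := unnormFilter ν χ q g t with hγt
  have : IsFiniteMeasure γ := M.isFiniteMeasure_unnormFilter (s + n)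
  have : IsFiniteMeasure γt := M.isFiniteMeasure_unnormFilter t
  have hLB : BddMeas L := M.bddMeas_Lop t k h1
  have hL0 : ∀ x, 0 ≤ L x := M.Lop_nonneg t k h1 fun _ => zero_le_one
  have hm : 0 < γ.real Set.univ := M.mass_pos hχg0 _
  have hP : 0 < ∫ x, L x ∂γt := by
    rw [M.integral_Lop t k h1]
    simpa using M.mass_pos hχg0 (t + k)
  -- the centring assumption passes to the backward mean
  have hcenter : ∫ x, A x * L x ∂γt = 0 := by
    have hcomp (x : X) := M.Lop_comp s (n + 1) k x h1
    simp only [← add_assoc, ← ht] at hcomp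
    have hLs : BddMeas fun x => Lop ν q g s (t + k) x fun _ => 1 := by
      simp only [hcomp]
      exact M.bddMeas_Lop s (n + 1) hLB
    rw [phismooth, M.philt_eq s (hhB.mul hLs), M.philt_eq s hLs] at hzero
    simp only [hcomp] at hzero
    have hnum := M.integral_mul_Lop hχg0 hB s (n + 1) hLB
    have hden := M.integral_Lop (χ := χ) s (n + 1) hLB
    simp only [← add_assoc, ← ht] at hnum hden
    have hms := (M.mass_pos hχg0 s).ne'
    rw [hnum, hden, div_div_div_cancel_right₀ hms, div_eq_zero_iff] at hzero
    exact hzero.resolve_right hP.ne'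
  have hAR (x : X) : |A x| ≤ R := by
    have low := integral_mono (((BddMeas.const c').mul hLB).integrable γt)
      (((hB (n + 1) s).mul hLB).integrable γt)
      fun x => mul_le_mul_of_nonneg_right (hc' x).1 (hL0 x)
    have up := integral_mono (((hB (n + 1) s).mul hLB).integrable γt)
      (((BddMeas.const (c' + R)).mul hLB).integrable γt)
      fun x => mul_le_mul_of_nonneg_right (hc' x).2 (hL0 x)
    rw [integral_const_mul, ← hA, hcenter] at low
    rw [integral_const_mul, ← hA, hcenter] at up
    have h₁ : c' ≤ 0 := nonpos_of_mul_nonpos_left low hP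
    have h₂ : 0 ≤ c' + R := nonneg_of_mul_nonneg_left up hP
    exact abs_le.2 ⟨by linarith [(hc' x).1], by linarith [(hc' x).2]⟩
  set W := ⨆ pr : X × X, |omegaFn q g ϑ p t pr.1 pr.2| with hW
  set Θ := ⨆ x, |ϑ t x| with hΘ
  set G := ⨆ x, |g t x| with hG
  have ht1 : 1 ≤ t := by omega
  have hω0 (x y : X) : 0 ≤ omegaFn q g ϑ p t x y :=
    div_nonneg (mul_nonneg (M.q_pos x y).le (hg0 t y))
      (mul_nonneg (hϑpos t ht1 x).le (hppos t ht1 x y).le)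
  have hωabs (pr : X × X) : |omegaFn q g ϑ p t pr.1 pr.2| ≤ Kω := by
    rw [abs_of_nonneg (hω0 _ _)]
    exact hKω t ht1 _ _
  have hωW (x y : X) : omegaFn q g ϑ p t x y ≤ W :=
    (le_abs_self _).trans (le_ciSup (f := fun pr : X × X => |omegaFn q g ϑ p t pr.1 pr.2|)
      ⟨Kω, by rintro _ ⟨pr, rfl⟩; exact hωabs pr⟩ (x, y))
  have hϑabs (x : X) : |ϑ t x| ≤ Kϑ := by
    rw [abs_of_pos (hϑpos t ht1 x)]
    exact hKϑ t ht1 x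
  have hϑΘ (x : X) : ϑ t x ≤ Θ :=
    (le_abs_self _).trans (le_ciSup (f := fun x => |ϑ t x|)
      ⟨Kϑ, by rintro _ ⟨y, rfl⟩; exact hϑabs y⟩ x)
  have hgG (x : X) : g t x ≤ G :=
    (le_abs_self _).trans (le_ciSup (f := fun x => |g t x|)
      ⟨Kg, by rintro _ ⟨y, rfl⟩; exact hgabs t y⟩ x)
  have hW0 : 0 ≤ W := Real.iSup_nonneg fun _ => abs_nonneg _
  have hΘ0 : 0 ≤ Θ := Real.iSup_nonneg fun _ => abs_nonneg _
  have hϑB : BddMeas (ϑ t) := ⟨hϑmeas t, Kϑ, hϑabs⟩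
  have hωB : BddMeas fun pr : X × X => omegaFn q g ϑ p t pr.1 pr.2 :=
    ⟨(M.bddMeas_qg t).1.div (((hϑmeas t).comp measurable_fst).mul (hpmeas t)), Kω, hωabs⟩
  -- rewriting of `υ` and its domination by the one-step operator applied to `L²`
  have hυ (x : X) : upsilon ν χ q g ϑ p h s t (t + k) x =
      ∫ y, q x y * g t y * omegaFn q g ϑ p t x y * ((A y * L y) * (A y * L y)) ∂ν := by
    rw [upsilon, ← integral_const_mul]
    refine integral_congr_ae (Filter.Eventually.of_forall fun y => ?_)
    have hϑ := (hϑpos t ht1 x).ne'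
    have hp := (hppos t ht1 x y).ne'
    simp only [ht, M.gstT_eq hχg0 hB hs n]
    simp only [← ht, ← hA]
    rw [show q x y * g t y = ϑ t x * p t x y * omegaFn q g ϑ p t x y by
      rw [omegaFn]; field_simp]
    ring
  have hAL : BddMeas fun y => (A y * L y) * (A y * L y) :=
    ((hB (n + 1) s).mul hLB).mul ((hB (n + 1) s).mul hLB)
  have hF : BddMeas fun pr : X × X => q pr.1 pr.2 * g t pr.2 *
      omegaFn q g ϑ p t pr.1 pr.2 * ((A pr.2 * L pr.2) * (A pr.2 * L pr.2)) :=
    ((M.bddMeas_qg t).mul hωB).mul (hAL.comp measurable_snd)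
  have hυB : BddMeas (upsilon ν χ q g ϑ p h s t (t + k)) := by
    rw [funext hυ]
    exact hF.integral (F := fun x y => q x y * g t y * omegaFn q g ϑ p t x y *
      ((A y * L y) * (A y * L y))) ν
  have hLL : BddMeas fun y => L y * L y := hLB.mul hLB
  have hυle (x : X) : upsilon ν χ q g ϑ p h s t (t + k) x ≤
      W * R ^ 2 * stepOp ν q (g t) (fun y => L y * L y) x := by
    rw [hυ, stepOp, ← integral_const_mul]
    refine integral_mono ((hF.comp (measurable_const.prodMk measurable_id)).integrable ν)
      (((BddMeas.const _).mul (((M.bddMeas_qg t).comp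
        (measurable_const.prodMk measurable_id)).mul hLL)).integrable ν) fun y => ?_
    have hqg0 : 0 ≤ q x y * g t y * (L y * L y) :=
      mul_nonneg (mul_nonneg (M.q_pos x y).le (hg0 t y)) (mul_self_nonneg _)
    have hsq : A y ^ 2 ≤ R ^ 2 := sq_le_sq' (abs_le.1 (hAR y)).1 (abs_le.1 (hAR y)).2
    have := mul_le_mul_of_nonneg_right
      (mul_le_mul (hωW x y) hsq (sq_nonneg _) hW0) hqg0
    simp only
    linarith
  have hυint : ∫ x, upsilon ν χ q g ϑ p h s t (t + k) x ∂γ ≤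
      W * R ^ 2 * ∫ x, L x * L x ∂γt := by
    rw [hγt, ht, ← M.integral_stepOp (s + n) hLL, ← integral_const_mul]
    exact integral_mono (hυB.integrable γ)
      (((BddMeas.const _).mul (M.bddMeas_stepOp t hLL)).integrable γ) hυle
  have hϑint : ∫ x, ϑ t x ∂γ ≤ Θ * γ.real Set.univ := by
    have := integral_mono (hϑB.integrable γ) ((BddMeas.const Θ).integrable γ) hϑΘ
    simpa [mul_comm] using this
  have hϑint0 : 0 ≤ ∫ x, ϑ t x ∂γ := integral_nonneg fun x => (hϑpos t ht1 x).le
  -- second moment of `L` against the square of its first moment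
  have hmoment : γt.real Set.univ * ∫ x, L x * L x ∂γt ≤ σp / σm * (∫ x, L x ∂γt) ^ 2 := by
    have hpt (y : X) : ∫ x, L x * L x ∂γt ≤ σp / σm * (∫ x, L x ∂γt) * L y := by
      rw [mul_right_comm, ← integral_const_mul]
      refine integral_mono (hLL.integrable γt) (((BddMeas.const _).mul hLB).integrable γt)
        fun x => mul_le_mul_of_nonneg_right (M.Lop_one_le_mul t k x y) (hL0 x)
    have := integral_mono ((BddMeas.const _).integrable γt)
      (((BddMeas.const _).mul hLB).integrable γt) hpt
    rw [integral_const, integral_const_mul, smul_eq_mul] at this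
    rw [sq, ← mul_assoc]
    exact this
  have hmass : cm * γ.real Set.univ ≤ γt.real Set.univ := M.mul_mass_le_mass_succ (s + n)
  have hcG : cm ≤ σp * G := by
    obtain ⟨x⟩ := hX
    have := integral_mono (((M.bddMeas_qg t).comp
      (measurable_const.prodMk measurable_id)).integrable ν)
      ((BddMeas.const (σp * G)).integrable ν) fun y =>
        mul_le_mul (hq x y).2 (hgG y) (hg0 t y) ((M.q_pos x y).le.trans (hq x y).2)
    simp only [integral_const, probReal_univ, one_smul] at this
    exact (hqg t ht1 x).trans this
  have hpred : phipred ν χ q g t (fun x => g t x * L x) =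
      (∫ x, L x ∂γt) / γ.real Set.univ := by
    have hstep : (fun x => ∫ y, q x y * (g t y * L y) ∂ν) = stepOp ν q (g t) L := by
      funext x
      simp only [stepOp, mul_assoc]
    rw [phipred, hstep, show t - 1 = s + n by omega, M.philt_eq _ (M.bddMeas_stepOp t hLB),
      M.integral_stepOp (s + n) hLB]
  rw [hpred, show t - 1 = s + n by omega, M.philt_eq _ hυB, M.philt_eq _ hϑB,
    show 2 * (t - s) = (n + 1) * 2 by omega, pow_mul, ← hγ]
  set P := ∫ x, L x ∂γt
  set S := ∫ x, L x * L x ∂γt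
  set m := γ.real Set.univ
  have hS0 : 0 ≤ S := integral_nonneg fun x => mul_self_nonneg _
  have hσp : 0 < σp := hσm.trans_le hσmp
  have hSP : m * S / P ^ 2 ≤ σp / (σm * cm) := by
    rw [div_le_div_iff₀ (by positivity) (by positivity)]
    have := (mul_le_mul_of_nonneg_right hmass hS0).trans hmoment
    rw [div_mul_eq_mul_div, le_div_iff₀ hσm] at this
    linarith
  have hconst : σp / (σm * cm) ≤ (σp ^ 2 / (σm * cm)) ^ 2 * G / σm := by
    rw [div_pow, div_mul_eq_mul_div, div_div, div_le_div_iff₀ (by positivity) (by positivity)]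
    have e₁ : σm ^ 2 * cm ≤ σp ^ 2 * (σp * G) :=
      mul_le_mul (pow_le_pow_left₀ hσm.le hσmp 2) hcG hcm.le (by positivity)
    have := mul_le_mul_of_nonneg_left e₁ (show 0 ≤ σp * σm * cm by positivity)
    linarith
  have hC : 0 ≤ W * R ^ 2 * Θ := by positivity
  calc _ = (∫ x, upsilon ν χ q g ϑ p h s t (t + k) x ∂γ) * (∫ x, ϑ t x ∂γ) / P ^ 2 := by
        field_simp
    _ ≤ (W * R ^ 2 * S) * (Θ * m) / P ^ 2 :=
        div_le_div_of_nonneg_right (mul_le_mul hυint hϑint hϑint0 (by positivity))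
          (sq_nonneg _)
    _ = W * R ^ 2 * Θ * (m * S / P ^ 2) := by ring
    _ ≤ W * R ^ 2 * Θ * ((σp ^ 2 / (σm * cm)) ^ 2 * G / σm) :=
        mul_le_mul_of_nonneg_left (hSP.trans hconst) hC
    _ = _ := by
        rw [hR]
        ring
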